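/- (Representation Theorem, sufficiency) Let X be a Banach space with an approximation scheme (A_n), let 0 < ρ < ∞ and 0 < μ ≤ ∞. If f ∈ X admits a representation f = Σ_{n=0}^∞ g_n (convergence in X) with g_n ∈ A_{2^n} for each n and (2^{nρ} ‖g_n‖_X)_{n≥0} ∈ ℓ_μ, then (n^{ρ − 1/μ} α_n(f, X))_{n≥1} ∈ ℓ_μ. -/

import Mathlib

open scoped ENNReal

/-- An approximation scheme on a Banach space `X`: a family of subsets `A n ⊆ X` with
`A 0 = {0}`, `A n ⊆ A (n+1)`, `λ • A n ⊆ A n`, `A m + A n ⊆ A (m+n)`, and `⋃ n, A n`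
dense in `X`. -/
structure ApproximationScheme (X : Type*) [NormedAddCommGroup X] [NormedSpace ℂ X] where
  A : ℕ → Set X
  zero_eq : A 0 = {0}
  mono : ∀ n : ℕ, A n ⊆ A (n + 1)
  smul_mem : ∀ (c : ℂ) (n : ℕ), ∀ a ∈ A n, c • a ∈ A n
  add_mem : ∀ (m n : ℕ), ∀ a ∈ A m, ∀ b ∈ A n, a + b ∈ A (m + n)
  dense : Dense (⋃ n : ℕ, A n)

variable {X : Type*} [NormedAddCommGroup X] [NormedSpace ℂ X]

/-- `approxError S f n` is the `(n+1)`-st approximation number `α_{n+1}(f, X)` of `f`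
with respect to the scheme `S`: the error of best approximation of `f` by elements
of `A n`. -/
noncomputable def approxError (S : ApproximationScheme X) (f : X) (n : ℕ) : ℝ :=
  sInf {c : ℝ | ∃ a ∈ S.A n, c = ‖f - a‖}

/-- Membership of a real sequence in `ℓ_μ` for `0 < μ ≤ ∞`: summability of `|c n| ^ μ`
for finite `μ`, boundedness for `μ = ∞`. -/
def MemEllMu (μ : ℝ≥0∞) (c : ℕ → ℝ) : Prop :=
  if μ = ∞ then ∃ M : ℝ, ∀ n : ℕ, |c n| ≤ M
  else Summable fun n : ℕ => |c n| ^ μ.toReal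

theorem aux_partial_mem (S : ApproximationScheme X) (g : ℕ → X)
    (hg : ∀ n : ℕ, g n ∈ S.A (2 ^ n)) (m : ℕ) :
    ∑ k ∈ Finset.range m, g k ∈ S.A (2 ^ m - 1) := by
  induction m with
  | zero => simp [S.zero_eq]
  | succ m ih =>
    rw [Finset.sum_range_succ]
    have h := S.add_mem _ _ _ ih _ (hg m)
    have e : 2 ^ m - 1 + 2 ^ m = 2 ^ (m + 1) - 1 := by
      have : 0 < 2 ^ m := by positivity
      rw [pow_succ]; omega
    rwa [e] at h

theorem aux_err_le (S : ApproximationScheme X) (f a : X) (n : ℕ) (ha : a ∈ S.A n) :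
    approxError S f n ≤ ‖f - a‖ := by
  apply csInf_le
  · exact ⟨0, by rintro c ⟨a, _, rfl⟩; positivity⟩
  · exact ⟨a, ha, rfl⟩

theorem aux_err_nonneg (S : ApproximationScheme X) (f : X) (n : ℕ) :
    0 ≤ approxError S f n := by
  apply Real.sInf_nonneg
  rintro c ⟨a, _, rfl⟩; positivity

/-- Key estimate. -/
theorem aux_key [CompleteSpace X] (S : ApproximationScheme X)
    (ρ : ℝ) (hρ : 0 < ρ) (f : X) (g : ℕ → X)
    (hg : ∀ n : ℕ, g n ∈ S.A (2 ^ n))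
    (hsum : Filter.Tendsto (fun N : ℕ => ∑ n ∈ Finset.range N, g n) Filter.atTop (nhds f))
    (r : ℝ) (hr0 : 0 < r) (hr1 : r < 1) (hr : r * r * (2 : ℝ) ^ ρ = 1)
    (n : ℕ) (E : ℝ)
    (hE : ∀ j : ℕ, r ^ j * ((2 : ℝ) ^ (((Nat.log 2 (n + 1) + j : ℕ) : ℝ) * ρ)
      * ‖g (Nat.log 2 (n + 1) + j)‖) ≤ E) :
    ((n : ℝ) + 1) ^ ρ * approxError S f n ≤ (2 : ℝ) ^ ρ / (1 - r) * E := by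
  set m := Nat.log 2 (n + 1) with hm
  set P : ℝ := (2 : ℝ) ^ ρ with hP
  have hP0 : 0 < P := by positivity
  have hpow : ∀ k : ℕ, (2 : ℝ) ^ ((k : ℝ) * ρ) = P ^ k := by
    intro k
    rw [mul_comm, Real.rpow_mul (by norm_num), Real.rpow_natCast]
  have h1 : 2 ^ m ≤ n + 1 := Nat.pow_log_le_self 2 (by omega)
  have h2 : n + 1 < 2 ^ (m + 1) := Nat.lt_pow_succ_log_self (by norm_num) _
  have hN : ((n : ℝ) + 1) ^ ρ ≤ P ^ (m + 1) := by
    rw [← hpow, Real.rpow_mul (by norm_num), Real.rpow_natCast]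
    apply Real.rpow_le_rpow (by positivity) _ hρ.le
    exact_mod_cast h2.le
  have hb : ∀ j : ℕ, ‖g (j + m)‖ ≤ (E / P ^ m) * r ^ j := by
    intro j
    have h := hE j
    rw [hpow, add_comm m j] at h
    have hone : r ^ j * r ^ j * P ^ j = 1 := by
      rw [← mul_pow, ← mul_pow, hr, one_pow]
    have : ‖g (j + m)‖ * P ^ m = r ^ j * (r ^ j * (P ^ (j + m) * ‖g (j + m)‖)) := by
      rw [pow_add]
      linear_combination (- (‖g (j + m)‖ * P ^ m)) * hone
    rw [div_mul_eq_mul_div, le_div_iff₀ (by positivity), this, mul_comm E]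
    gcongr
  have hgeo : HasSum (fun j : ℕ => (E / P ^ m) * r ^ j) ((E / P ^ m) * (1 - r)⁻¹) :=
    (hasSum_geometric_of_lt_one hr0.le hr1).mul_left _
  have hs : Summable g := by
    rw [← summable_nat_add_iff m]
    exact Summable.of_norm_bounded hgeo.summable hb
  have hf : ∑' k, g k = f := tendsto_nhds_unique hs.hasSum.tendsto_sum_nat hsum
  have htail : ‖f - ∑ k ∈ Finset.range m, g k‖ ≤ (E / P ^ m) * (1 - r)⁻¹ := by
    rw [← hf, ← hs.sum_add_tsum_nat_add m, add_sub_cancel_left]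
    exact tsum_of_norm_bounded hgeo hb
  have hmem : ∑ k ∈ Finset.range m, g k ∈ S.A n :=
    monotone_nat_of_le_succ S.mono (by omega : 2 ^ m - 1 ≤ n) (aux_partial_mem S g hg m)
  have herr := (aux_err_le S f _ n hmem).trans htail
  calc ((n : ℝ) + 1) ^ ρ * approxError S f n
      ≤ P ^ (m + 1) * ((E / P ^ m) * (1 - r)⁻¹) :=
        mul_le_mul hN herr (aux_err_nonneg S f n) (by positivity)
    _ = P / (1 - r) * E := by
        have : 1 - r ≠ 0 := by linarith
        field_simp
        ring

theorem aux_block (e : ℕ → ℝ) (he : ∀ m, 0 ≤ e m) (hs : Summable e) :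
    Summable fun n : ℕ => ((2 : ℝ) ^ (Nat.log 2 (n + 1)))⁻¹ * e (Nat.log 2 (n + 1)) := by
  have hnn : ∀ n : ℕ, 0 ≤ ((2 : ℝ) ^ (Nat.log 2 (n + 1)))⁻¹ * e (Nat.log 2 (n + 1)) :=
    fun n => mul_nonneg (by positivity) (he _)
  have key : ∀ M : ℕ, ∑ n ∈ Finset.range (2 ^ M - 1),
      ((2 : ℝ) ^ (Nat.log 2 (n + 1)))⁻¹ * e (Nat.log 2 (n + 1)) = ∑ m ∈ Finset.range M, e m := by
    intro M
    induction M with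
    | zero => simp
    | succ M ih =>
      have hp : 0 < 2 ^ M := by positivity
      have e1 : 2 ^ (M + 1) - 1 = (2 ^ M - 1) + 2 ^ M := by
        rw [pow_succ]; omega
      rw [e1, Finset.sum_range_add, ih, Finset.sum_range_succ]
      congr 1
      have : ∀ i ∈ Finset.range (2 ^ M), ((2 : ℝ) ^ (Nat.log 2 (2 ^ M - 1 + i + 1)))⁻¹ *
          e (Nat.log 2 (2 ^ M - 1 + i + 1)) = ((2 : ℝ) ^ M)⁻¹ * e M := by
        intro i hi
        rw [Finset.mem_range] at hi
        have : Nat.log 2 (2 ^ M - 1 + i + 1) = M := by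
          rw [Nat.log_eq_iff (by right; omega)]
          rw [pow_succ]; omega
        rw [this]
      rw [Finset.sum_congr rfl this]
      simp
  refine summable_of_sum_range_le (c := ∑' m, e m) hnn fun n => ?_
  have hle : n ≤ 2 ^ n - 1 := by
    have : n < 2 ^ n := Nat.lt_two_pow_self
    omega
  refine (Finset.sum_le_sum_of_subset_of_nonneg (Finset.range_mono hle) fun i _ _ => hnn i).trans ?_
  rw [key]
  exact hs.sum_le_tsum _ fun i _ => he i

theorem aux_shear (u v : ℕ → ℝ) (h : Summable fun x : ℕ × ℕ => u x.1 * v x.2) :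
    Summable fun x : ℕ × ℕ => u x.2 * v (x.1 + x.2) := by
  have hinj : Function.Injective (fun x : ℕ × ℕ => (x.2, x.1 + x.2)) := by
    rintro ⟨a, c⟩ ⟨a', c'⟩ h
    simp only [Prod.mk.injEq] at h ⊢
    omega
  exact h.comp_injective hinj

/-- **Representation theorem (sufficiency).** For an approximation scheme on a Banach
space `X`, `0 < ρ < ∞` and `0 < μ ≤ ∞`: if `f = Σ_n g n` (convergence in `X`) with
`g n ∈ A (2^n)` and `(2^{nρ} ‖g n‖) ∈ ℓ_μ`, then `(n^{ρ - 1/μ} α_n(f, X)) ∈ ℓ_μ`.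
(Here `approxError S f n = α_{n+1}(f, X)`, and `ρ - 1/μ` is `ρ` when `μ = ∞`.) -/
theorem representation_sufficiency [CompleteSpace X] (S : ApproximationScheme X)
    (ρ : ℝ) (hρ : 0 < ρ) (μ : ℝ≥0∞) (hμ : 0 < μ) (f : X) (g : ℕ → X)
    (hg : ∀ n : ℕ, g n ∈ S.A (2 ^ n))
    (hsum : Filter.Tendsto (fun N : ℕ => ∑ n ∈ Finset.range N, g n) Filter.atTop (nhds f))
    (hℓ : MemEllMu μ fun n => (2 : ℝ) ^ ((n : ℝ) * ρ) * ‖g n‖) :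
    MemEllMu μ fun n =>
      ((n : ℝ) + 1) ^ (ρ - (μ⁻¹).toReal) * approxError S f n := by
  obtain ⟨r, hr0, hr1, hr⟩ : ∃ r : ℝ, 0 < r ∧ r < 1 ∧ r * r * (2 : ℝ) ^ ρ = 1 := by
    refine ⟨(2 : ℝ) ^ (-ρ / 2), by positivity, ?_, ?_⟩
    · exact Real.rpow_lt_one_of_one_lt_of_neg (by norm_num) (by linarith)
    · rw [← Real.rpow_add (by norm_num), ← Real.rpow_add (by norm_num)]
      ring_nf
      simp
  set b : ℕ → ℝ := fun n => (2 : ℝ) ^ ((n : ℝ) * ρ) * ‖g n‖ with hb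
  have hb0 : ∀ n, 0 ≤ b n := fun n => by positivity
  have hkey := aux_key S ρ hρ f g hg hsum r hr0 hr1 hr
  have h1r : 0 < 1 - r := by linarith
  unfold MemEllMu at hℓ ⊢
  split_ifs at hℓ ⊢ with hμt
  · obtain ⟨M, hM⟩ := hℓ
    refine ⟨(2 : ℝ) ^ ρ / (1 - r) * M, fun n => ?_⟩
    have hnn := aux_err_nonneg S f n
    rw [abs_of_nonneg (by positivity)]
    simp only [hμt, ENNReal.inv_top, ENNReal.toReal_zero, sub_zero]
    refine hkey n M fun j => ?_
    have h := hM (Nat.log 2 (n + 1) + j)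
    rw [abs_of_nonneg (hb0 _)] at h
    exact (mul_le_of_le_one_left (hb0 _) (pow_le_one₀ hr0.le hr1.le)).trans h
  · set p := μ.toReal with hp
    have hp0 : 0 < p := ENNReal.toReal_pos hμ.ne' hμt
    rw [ENNReal.toReal_inv, ← hp]
    have hℓ' : Summable fun n => b n ^ p := by
      refine hℓ.congr fun n => ?_
      rw [abs_of_nonneg (hb0 n)]
    obtain ⟨s, hs⟩ : ∃ s, s = r ^ p := ⟨_, rfl⟩
    have hs0 : 0 < s := by rw [hs]; positivity
    have hs1 : s < 1 := hs ▸ Real.rpow_lt_one hr0.le hr1 hp0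
    have hprod : Summable fun x : ℕ × ℕ => s ^ x.1 * b x.2 ^ p :=
      (summable_geometric_of_lt_one hs0.le hs1).mul_of_nonneg hℓ'
        (fun i => by positivity) (fun i => Real.rpow_nonneg (hb0 i) _)
    have h2 : Summable fun x : ℕ × ℕ => s ^ x.2 * b (x.1 + x.2) ^ p :=
      aux_shear (fun i => s ^ i) (fun k => b k ^ p) hprod
    set D : ℕ → ℝ := fun m => ∑' j, s ^ j * b (m + j) ^ p with hD
    have hDs : Summable D := h2.prod
    have hterm : ∀ m j, 0 ≤ s ^ j * b (m + j) ^ p := fun m j =>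
      mul_nonneg (by positivity) (Real.rpow_nonneg (hb0 _) _)
    have hD0 : ∀ m, 0 ≤ D m := fun m => tsum_nonneg (hterm m)
    have hDle : ∀ m j, r ^ j * b (m + j) ≤ D m ^ p⁻¹ := by
      intro m j
      have h3 : s ^ j * b (m + j) ^ p ≤ D m :=
        (h2.prod_factor m).le_tsum j fun i _ => hterm m i
      rw [Real.le_rpow_inv_iff_of_pos (mul_nonneg (by positivity) (hb0 _)) (hD0 m) hp0,
        Real.mul_rpow (by positivity) (hb0 _)]
      have hrs : (r ^ j) ^ p = s ^ j := by
        rw [hs]; exact (Real.rpow_pow_comm hr0.le p j).symm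
      rw [hrs]
      exact h3
    refine Summable.of_nonneg_of_le (fun n => by positivity) (fun n => ?_)
      ((aux_block D hD0 hDs).mul_left (2 * ((2 : ℝ) ^ ρ / (1 - r)) ^ p))
    have hk := hkey n (D (Nat.log 2 (n + 1)) ^ p⁻¹) fun j => hDle _ j
    set m := Nat.log 2 (n + 1) with hm
    have hnn := aux_err_nonneg S f n
    have hn0 : (0 : ℝ) < (n : ℝ) + 1 := by positivity
    have hk2 := Real.rpow_le_rpow (by positivity) hk hp0.le
    rw [Real.mul_rpow (by positivity) (Real.rpow_nonneg (hD0 m) _),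
      Real.rpow_inv_rpow (hD0 m) hp0.ne'] at hk2
    have h1 : 2 ^ m ≤ n + 1 := Nat.pow_log_le_self 2 (by omega)
    have h1' : ((n : ℝ) + 1)⁻¹ ≤ ((2 : ℝ) ^ m)⁻¹ := by
      apply inv_anti₀ (by positivity)
      exact_mod_cast h1
    have heq : |((n : ℝ) + 1) ^ (ρ - p⁻¹) * approxError S f n| ^ p
        = ((n : ℝ) + 1)⁻¹ * (((n : ℝ) + 1) ^ ρ * approxError S f n) ^ p := by
      rw [abs_of_nonneg (by positivity), Real.rpow_sub hn0, div_mul_eq_mul_div,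
        Real.div_rpow (by positivity) (by positivity), Real.rpow_inv_rpow hn0.le hp0.ne']
      ring
    rw [heq]
    have hC : 0 ≤ ((2 : ℝ) ^ ρ / (1 - r)) ^ p * D m :=
      mul_nonneg (by positivity) (hD0 m)
    calc _ ≤ ((2 : ℝ) ^ m)⁻¹ * (((2 : ℝ) ^ ρ / (1 - r)) ^ p * D m) :=
          mul_le_mul h1' hk2 (by positivity) (by positivity)
      _ ≤ 2 * (((2 : ℝ) ^ m)⁻¹ * (((2 : ℝ) ^ ρ / (1 - r)) ^ p * D m)) := by
          have : 0 ≤ ((2 : ℝ) ^ m)⁻¹ * (((2 : ℝ) ^ ρ / (1 - r)) ^ p * D m) := by positivity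
          linarith
      _ = _ := by ring
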